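/- Let v₁, v₂ : ℝ → ℝ be smooth and let P̂ be the reduced second Poisson tensor, i.e. P̂(b₂, b₁) = (-6b₂' + 3(b₁' - v₂b₁)', -3(b₂'' + v₂b₂') + 2b₁''' + v₁b₁' + (v₁b₁)' + 2v₂b₁'' - 2(v₂b₁)'' - 2v₂(v₂b₁)'). Then P̂ is formally skew-adjoint: for all smooth compactly supported pairs (b₂, b₁) and (c₂, c₁) of functions ℝ → ℝ, ∫_ℝ [c₂·(first component of P̂(b₂,b₁)) + c₁·(second component of P̂(b₂,b₁))] dx = -∫_ℝ [b₂·(first component of P̂(c₂,c₁)) + b₁·(second component of P̂(c₂,c₁))] dx. -/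

import Mathlib

open MeasureTheory

/-- First component of the reduced second Poisson tensor `P̂` of the n = 3
reduced constrained MKP hierarchy: `-6b₂' + 3(b₁' - v₂b₁)'`. -/
noncomputable def PhatFst (v₂ b₂ b₁ : ℝ → ℝ) : ℝ → ℝ :=
  fun x => -6 * deriv b₂ x + 3 * deriv (fun y => deriv b₁ y - v₂ y * b₁ y) x

/-- Second component of the reduced second Poisson tensor `P̂`:
`-3(b₂'' + v₂b₂') + 2b₁''' + v₁b₁' + (v₁b₁)' + 2v₂b₁'' - 2(v₂b₁)'' - 2v₂(v₂b₁)'`. -/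
noncomputable def PhatSnd (v₂ v₁ b₂ b₁ : ℝ → ℝ) : ℝ → ℝ :=
  fun x =>
    -3 * (deriv (deriv b₂) x + v₂ x * deriv b₂ x)
      + 2 * deriv (deriv (deriv b₁)) x + v₁ x * deriv b₁ x
      + deriv (fun y => v₁ y * b₁ y) x + 2 * v₂ x * deriv (deriv b₁) x
      - 2 * deriv (deriv (fun y => v₂ y * b₁ y)) x
      - 2 * v₂ x * deriv (fun y => v₂ y * b₁ y) x

theorem ContDiff.deriv_top {f : ℝ → ℝ} (hf : ContDiff ℝ (⊤ : ℕ∞) f) :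
    ContDiff ℝ (⊤ : ℕ∞) (deriv f) :=
  (contDiff_infty_iff_deriv.1 hf).2

theorem ContDiff.hasDerivAt_top {f : ℝ → ℝ} (hf : ContDiff ℝ (⊤ : ℕ∞) f) (x : ℝ) :
    HasDerivAt f (deriv f x) x :=
  ((contDiff_infty_iff_deriv.1 hf).1 x).hasDerivAt

theorem deriv_mul_of_smooth {f g : ℝ → ℝ}
    (hf : ContDiff ℝ (⊤ : ℕ∞) f) (hg : ContDiff ℝ (⊤ : ℕ∞) g) :
    deriv (fun y => f y * g y) = fun x => deriv f x * g x + f x * deriv g x :=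
  funext fun x => ((hf.hasDerivAt_top x).fun_mul (hg.hasDerivAt_top x)).deriv

/-- `PhatFst` with all derivatives of products expanded. -/
theorem PhatFst_eq {v₂ b₂ b₁ : ℝ → ℝ} (hv₂ : ContDiff ℝ (⊤ : ℕ∞) v₂)
    (hb₁ : ContDiff ℝ (⊤ : ℕ∞) b₁) :
    PhatFst v₂ b₂ b₁ = fun x => -6 * deriv b₂ x
      + 3 * (deriv (deriv b₁) x - (deriv v₂ x * b₁ x + v₂ x * deriv b₁ x)) := by
  funext x
  rw [PhatFst, ((hb₁.deriv_top.hasDerivAt_top x).fun_sub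
    ((hv₂.hasDerivAt_top x).fun_mul (hb₁.hasDerivAt_top x))).deriv]

/-- `PhatSnd` with all derivatives of products expanded. -/
theorem PhatSnd_eq {v₂ v₁ b₂ b₁ : ℝ → ℝ} (hv₂ : ContDiff ℝ (⊤ : ℕ∞) v₂)
    (hv₁ : ContDiff ℝ (⊤ : ℕ∞) v₁) (hb₁ : ContDiff ℝ (⊤ : ℕ∞) b₁) :
    PhatSnd v₂ v₁ b₂ b₁ = fun x =>
      -3 * (deriv (deriv b₂) x + v₂ x * deriv b₂ x)
      + 2 * deriv (deriv (deriv b₁)) x + v₁ x * deriv b₁ x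
      + (deriv v₁ x * b₁ x + v₁ x * deriv b₁ x) + 2 * v₂ x * deriv (deriv b₁) x
      - 2 * (deriv (deriv v₂) x * b₁ x + deriv v₂ x * deriv b₁ x
        + (deriv v₂ x * deriv b₁ x + v₂ x * deriv (deriv b₁) x))
      - 2 * v₂ x * (deriv v₂ x * b₁ x + v₂ x * deriv b₁ x) := by
  funext x
  rw [PhatSnd, deriv_mul_of_smooth hv₁ hb₁, deriv_mul_of_smooth hv₂ hb₁,
    (((hv₂.deriv_top.hasDerivAt_top x).fun_mul (hb₁.hasDerivAt_top x)).fun_add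
      ((hv₂.hasDerivAt_top x).fun_mul (hb₁.deriv_top.hasDerivAt_top x))).deriv]

theorem integrable_mul_PhatFst_add_mul_PhatSnd {v₂ v₁ b₂ b₁ c₂ c₁ : ℝ → ℝ}
    (hv₂ : ContDiff ℝ (⊤ : ℕ∞) v₂) (hv₁ : ContDiff ℝ (⊤ : ℕ∞) v₁)
    (hb₂ : ContDiff ℝ (⊤ : ℕ∞) b₂) (hb₁ : ContDiff ℝ (⊤ : ℕ∞) b₁)
    (hc₂ : Continuous c₂) (hc₁ : Continuous c₁)
    (hc₂s : HasCompactSupport c₂) (hc₁s : HasCompactSupport c₁) :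
    Integrable fun x => c₂ x * PhatFst v₂ b₂ b₁ x + c₁ x * PhatSnd v₂ v₁ b₂ b₁ x := by
  refine Continuous.integrable_of_hasCompactSupport ?_
    (hc₂s.mul_right.add hc₁s.mul_right)
  rw [PhatFst_eq hv₂ hb₁, PhatSnd_eq hv₂ hv₁ hb₁]
  have := hv₂.continuous
  have := hv₂.deriv_top.continuous
  have := hv₂.deriv_top.deriv_top.continuous
  have := hv₁.continuous
  have := hv₁.deriv_top.continuous
  have := hb₂.deriv_top.continuous
  have := hb₂.deriv_top.deriv_top.continuous
  have := hb₁.continuous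
  have := hb₁.deriv_top.continuous
  have := hb₁.deriv_top.deriv_top.continuous
  have := hb₁.deriv_top.deriv_top.deriv_top.continuous
  fun_prop

/-- The boundary term: a primitive of the symmetrized pairing
`⟨c, P̂ b⟩ + ⟨b, P̂ c⟩`. -/
noncomputable def PhatBoundary (v₂ v₁ b₂ b₁ c₂ c₁ : ℝ → ℝ) : ℝ → ℝ :=
  fun x => c₂ x * (-6 * b₂ x + 3 * deriv b₁ x - 3 * (v₂ x * b₁ x))
    + deriv c₂ x * (-3 * b₁ x)
    + c₁ x * (-3 * deriv b₂ x - 3 * (v₂ x * b₂ x) + 2 * deriv (deriv b₁) x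
        + 2 * (v₁ x * b₁ x) - 4 * (deriv v₂ x * b₁ x) - 2 * (v₂ x * (v₂ x * b₁ x)))
    + deriv c₁ x * (3 * b₂ x - 2 * deriv b₁ x)
    + deriv (deriv c₁) x * (2 * b₁ x)

theorem hasDerivAt_PhatBoundary {v₂ v₁ b₂ b₁ c₂ c₁ : ℝ → ℝ}
    (hv₂ : ContDiff ℝ (⊤ : ℕ∞) v₂) (hv₁ : ContDiff ℝ (⊤ : ℕ∞) v₁)
    (hb₂ : ContDiff ℝ (⊤ : ℕ∞) b₂) (hb₁ : ContDiff ℝ (⊤ : ℕ∞) b₁)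
    (hc₂ : ContDiff ℝ (⊤ : ℕ∞) c₂) (hc₁ : ContDiff ℝ (⊤ : ℕ∞) c₁) (x : ℝ) :
    HasDerivAt (PhatBoundary v₂ v₁ b₂ b₁ c₂ c₁)
      ((c₂ x * PhatFst v₂ b₂ b₁ x + c₁ x * PhatSnd v₂ v₁ b₂ b₁ x)
        + (b₂ x * PhatFst v₂ c₂ c₁ x + b₁ x * PhatSnd v₂ v₁ c₂ c₁ x)) x := by
  rw [PhatFst_eq hv₂ hb₁, PhatSnd_eq hv₂ hv₁ hb₁, PhatFst_eq hv₂ hc₁, PhatSnd_eq hv₂ hv₁ hc₁]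
  have v := hv₂.hasDerivAt_top x
  have dv := hv₂.deriv_top.hasDerivAt_top x
  have w := hv₁.hasDerivAt_top x
  have b := hb₂.hasDerivAt_top x
  have db := hb₂.deriv_top.hasDerivAt_top x
  have β := hb₁.hasDerivAt_top x
  have dβ := hb₁.deriv_top.hasDerivAt_top x
  have ddβ := hb₁.deriv_top.deriv_top.hasDerivAt_top x
  have c := hc₂.hasDerivAt_top x
  have dc := hc₂.deriv_top.hasDerivAt_top x
  have γ := hc₁.hasDerivAt_top x
  have dγ := hc₁.deriv_top.hasDerivAt_top x
  have ddγ := hc₁.deriv_top.deriv_top.hasDerivAt_top x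
  have h₁ := c.fun_mul (((b.const_mul (-6)).fun_add (dβ.const_mul 3)).fun_sub
    ((v.fun_mul β).const_mul 3))
  have h₂ := dc.fun_mul (β.const_mul (-3))
  have h₃ := γ.fun_mul ((((((db.const_mul (-3)).fun_sub ((v.fun_mul b).const_mul 3)).fun_add
    (ddβ.const_mul 2)).fun_add ((w.fun_mul β).const_mul 2)).fun_sub
    ((dv.fun_mul β).const_mul 4)).fun_sub ((v.fun_mul (v.fun_mul β)).const_mul 2))
  have h₄ := dγ.fun_mul ((b.const_mul 3).fun_sub (dβ.const_mul 2))
  have h₅ := ddγ.fun_mul (β.const_mul 2)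
  exact ((((h₁.fun_add h₂).fun_add h₃).fun_add h₄).fun_add h₅).congr_deriv (by ring)

theorem hasCompactSupport_PhatBoundary {v₂ v₁ b₂ b₁ c₂ c₁ : ℝ → ℝ}
    (hc₂s : HasCompactSupport c₂) (hc₁s : HasCompactSupport c₁) :
    HasCompactSupport (PhatBoundary v₂ v₁ b₂ b₁ c₂ c₁) :=
  (((hc₂s.mul_right.add hc₂s.deriv.mul_right).add hc₁s.mul_right).add
    hc₁s.deriv.mul_right).add hc₁s.deriv.deriv.mul_right

/-- **Formal skew-adjointness of the reduced second Poisson tensor `P̂`.**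
For smooth `v₁ v₂` and smooth compactly supported pairs `(b₂, b₁)`, `(c₂, c₁)`,
`∫ (c₂·P̂(b₂,b₁)₁ + c₁·P̂(b₂,b₁)₂) = -∫ (b₂·P̂(c₂,c₁)₁ + b₁·P̂(c₂,c₁)₂)`. -/
theorem Phat_skew_adjoint
    (v₂ v₁ : ℝ → ℝ) (hv₂ : ContDiff ℝ (⊤ : ℕ∞) v₂) (hv₁ : ContDiff ℝ (⊤ : ℕ∞) v₁)
    (b₂ b₁ c₂ c₁ : ℝ → ℝ)
    (hb₂ : ContDiff ℝ (⊤ : ℕ∞) b₂) (hb₁ : ContDiff ℝ (⊤ : ℕ∞) b₁)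
    (hc₂ : ContDiff ℝ (⊤ : ℕ∞) c₂) (hc₁ : ContDiff ℝ (⊤ : ℕ∞) c₁)
    (hb₂s : HasCompactSupport b₂) (hb₁s : HasCompactSupport b₁)
    (hc₂s : HasCompactSupport c₂) (hc₁s : HasCompactSupport c₁) :
    ∫ x : ℝ, (c₂ x * PhatFst v₂ b₂ b₁ x + c₁ x * PhatSnd v₂ v₁ b₂ b₁ x)
      = -∫ x : ℝ, (b₂ x * PhatFst v₂ c₂ c₁ x + b₁ x * PhatSnd v₂ v₁ c₂ c₁ x) := by
  have hb := integrable_mul_PhatFst_add_mul_PhatSnd hv₂ hv₁ hb₂ hb₁ hc₂.continuous hc₁.continuous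
    hc₂s hc₁s
  have hc := integrable_mul_PhatFst_add_mul_PhatSnd hv₂ hv₁ hc₂ hc₁ hb₂.continuous hb₁.continuous
    hb₂s hb₁s
  have hderiv := hasDerivAt_PhatBoundary hv₂ hv₁ hb₂ hb₁ hc₂ hc₁
  have hcont : Continuous (PhatBoundary v₂ v₁ b₂ b₁ c₂ c₁) :=
    continuous_iff_continuousAt.2 fun x => (hderiv x).continuousAt
  rw [eq_neg_iff_add_eq_zero, ← integral_add hb hc]
  exact integral_eq_zero_of_hasDerivAt_of_integrable hderiv (hb.add hc)
    (hcont.integrable_of_hasCompactSupport (hasCompactSupport_PhatBoundary hc₂s hc₁s))
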